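/- A lightcone framed curve (γ,ℓ⁺,ℓ⁻) : I → ℝ³₁ × Δ₄ with lightcone curvature (κ₁,κ₂,κ₃,α,β) is an (ℓ̃⁺,ℓ̄⁺)-Bertrand lightcone framed curve if and only if there exist smooth functions λ, k : I → ℝ with λ ≢ 0 such that k(t)(α(t)+β(t)) + α(t) − β(t) + λ(t)(κ₁(t)+κ₂(t)−κ₃(t)) = 0 for all t ∈ I. -/

import Mathlib

open Matrix

noncomputable section

/-- The Minkowski pseudo-scalar product on `ℝ³`:
`⟨x,y⟩ = −x₁y₁ + x₂y₂ + x₃y₃`. -/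
def mdot (x y : Fin 3 → ℝ) : ℝ := -(x 0 * y 0) + x 1 * y 1 + x 2 * y 2

/-- The pseudo vector product `x ∧ y` on Minkowski `ℝ³`, i.e. the determinant of the
matrix with rows `(−e₁, e₂, e₃)`, `x`, `y`. -/
def mcross (x y : Fin 3 → ℝ) : Fin 3 → ℝ :=
  ![-(x 1 * y 2 - x 2 * y 1), x 2 * y 0 - x 0 * y 2, x 0 * y 1 - x 1 * y 0]

/-- The (punctured) lightcone `LC* = {x ≠ 0 : ⟨x,x⟩ = 0}`. -/
def LCstar (x : Fin 3 → ℝ) : Prop := x ≠ 0 ∧ mdot x x = 0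

/-- Membership in `Δ₄ = {(v,w) ∈ LC* × LC* : ⟨v,w⟩ = −2}`. -/
def MemDelta4 (v w : Fin 3 → ℝ) : Prop := LCstar v ∧ LCstar w ∧ mdot v w = -2

/-- `n(t) = −(1/2) ℓ⁺(t) ∧ ℓ⁻(t)`. -/
def lcn (lp lm : ℝ → Fin 3 → ℝ) : ℝ → Fin 3 → ℝ :=
  fun t => (-(1/2) : ℝ) • mcross (lp t) (lm t)

/-- Smoothness (on `I`) of a real valued function. -/
def Smooth1 (I : Set ℝ) (f : ℝ → ℝ) : Prop := ContDiffOn ℝ (⊤ : ℕ∞) f I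

/-- Smoothness (on `I`) of an `ℝ³`-valued function. -/
def Smooth3 (I : Set ℝ) (f : ℝ → Fin 3 → ℝ) : Prop := ContDiffOn ℝ (⊤ : ℕ∞) f I

/-- `λ ≢ 0` : the set where `λ` is non-zero is dense in `I`. -/
def NotIdentZero (I : Set ℝ) (f : ℝ → ℝ) : Prop :=
  I ⊆ closure {t | t ∈ I ∧ f t ≠ 0}

/-- A lightcone framed curve `(γ, ℓ⁺, ℓ⁻) : I → ℝ³₁ × Δ₄`. -/
structure IsLightconeFramedCurve (I : Set ℝ) (γ lp lm : ℝ → Fin 3 → ℝ) : Prop where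
  smooth_base : Smooth3 I γ
  smooth_lp : Smooth3 I lp
  smooth_lm : Smooth3 I lm
  delta4 : ∀ t ∈ I, MemDelta4 (lp t) (lm t)
  exists_coeffs : ∃ α β : ℝ → ℝ, Smooth1 I α ∧ Smooth1 I β ∧
    ∀ t ∈ I, deriv γ t = α t • lp t + β t • lm t

/-- `(κ₁, κ₂, κ₃, α, β)` is the lightcone curvature of the lightcone framed curve
`(γ, ℓ⁺, ℓ⁻)`. -/
structure HasLightconeCurvature (I : Set ℝ) (γ lp lm : ℝ → Fin 3 → ℝ)
    (κ₁ κ₂ κ₃ α β : ℝ → ℝ) : Prop where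
  smooth_κ₁ : Smooth1 I κ₁
  smooth_κ₂ : Smooth1 I κ₂
  smooth_κ₃ : Smooth1 I κ₃
  smooth_α : Smooth1 I α
  smooth_β : Smooth1 I β
  deriv_lp : ∀ t ∈ I, deriv lp t = κ₁ t • lp t + (2 * κ₃ t) • lcn lp lm t
  deriv_lm : ∀ t ∈ I, deriv lm t = (-κ₁ t) • lm t + (2 * κ₂ t) • lcn lp lm t
  deriv_n : ∀ t ∈ I, deriv (lcn lp lm) t = κ₂ t • lp t + κ₃ t • lm t
  deriv_base : ∀ t ∈ I, deriv γ t = α t • lp t + β t • lm t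

/-- The vector field `ℓ⁺` built from a lightcone frame. -/
def fieldLp (lp lm : ℝ → Fin 3 → ℝ) : ℝ → Fin 3 → ℝ := fun t => lp t
/-- The vector field `ℓ⁻` built from a lightcone frame. -/
def fieldLm (lp lm : ℝ → Fin 3 → ℝ) : ℝ → Fin 3 → ℝ := fun t => lm t
/-- `nᵀ = (ℓ⁺ + ℓ⁻)/2`. -/
def fieldNT (lp lm : ℝ → Fin 3 → ℝ) : ℝ → Fin 3 → ℝ := fun t => (1/2 : ℝ) • (lp t + lm t)
/-- `nˢ = (ℓ⁺ − ℓ⁻)/2`. -/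
def fieldNS (lp lm : ℝ → Fin 3 → ℝ) : ℝ → Fin 3 → ℝ := fun t => (1/2 : ℝ) • (lp t - lm t)
/-- `n = −(1/2) ℓ⁺ ∧ ℓ⁻`. -/
def fieldN (lp lm : ℝ → Fin 3 → ℝ) : ℝ → Fin 3 → ℝ := lcn lp lm
/-- `ℓ̃⁺ = nᵀ + n`. -/
def fieldLtp (lp lm : ℝ → Fin 3 → ℝ) : ℝ → Fin 3 → ℝ :=
  fun t => fieldNT lp lm t + fieldN lp lm t
/-- `ℓ̃⁻ = nᵀ − n`. -/
def fieldLtm (lp lm : ℝ → Fin 3 → ℝ) : ℝ → Fin 3 → ℝ :=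
  fun t => fieldNT lp lm t - fieldN lp lm t

/-- `(γ,ℓ⁺,ℓ⁻)` and `(γ̄,ℓ̄⁺,ℓ̄⁻)` are `(v,w̄)`-mates. -/
def AreMates (I : Set ℝ)
    (v w : (ℝ → Fin 3 → ℝ) → (ℝ → Fin 3 → ℝ) → ℝ → Fin 3 → ℝ)
    (γ lp lm γ' lp' lm' : ℝ → Fin 3 → ℝ) : Prop :=
  IsLightconeFramedCurve I γ lp lm ∧ IsLightconeFramedCurve I γ' lp' lm' ∧
  ∃ lam : ℝ → ℝ, Smooth1 I lam ∧ NotIdentZero I lam ∧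
    (∀ t ∈ I, γ' t = γ t + lam t • v lp lm t) ∧
    (∀ t ∈ I, v lp lm t = w lp' lm' t)

/-- `(γ,ℓ⁺,ℓ⁻)` is a `(v,w̄)`-Bertrand lightcone framed curve. -/
def IsBertrand (I : Set ℝ)
    (v w : (ℝ → Fin 3 → ℝ) → (ℝ → Fin 3 → ℝ) → ℝ → Fin 3 → ℝ)
    (γ lp lm : ℝ → Fin 3 → ℝ) : Prop :=
  ∃ γ' lp' lm' : ℝ → Fin 3 → ℝ, AreMates I v w γ lp lm γ' lp' lm'

theorem mdot_add_left (x y z : Fin 3 → ℝ) : mdot (x + y) z = mdot x z + mdot y z := by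
  simp only [mdot, Pi.add_apply]; ring

theorem mdot_smul_left (c : ℝ) (x y : Fin 3 → ℝ) : mdot (c • x) y = c * mdot x y := by
  simp only [mdot, Pi.smul_apply, smul_eq_mul]; ring

theorem mdot_sub_left (x y z : Fin 3 → ℝ) : mdot (x - y) z = mdot x z - mdot y z := by
  simp only [mdot, Pi.sub_apply]; ring

theorem mdot_comm (x y : Fin 3 → ℝ) : mdot x y = mdot y x := by
  simp only [mdot]; ring

theorem mdot_add_right (x y z : Fin 3 → ℝ) : mdot x (y + z) = mdot x y + mdot x z := by
  simp only [mdot, Pi.add_apply]; ring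

theorem mdot_smul_right (c : ℝ) (x y : Fin 3 → ℝ) : mdot x (c • y) = c * mdot x y := by
  simp only [mdot, Pi.smul_apply, smul_eq_mul]; ring

theorem mdot_sub_right (x y z : Fin 3 → ℝ) : mdot x (y - z) = mdot x y - mdot x z := by
  simp only [mdot, Pi.sub_apply]; ring

theorem mdot_mcross_left (x y : Fin 3 → ℝ) : mdot (mcross x y) x = 0 := by
  simp only [mdot, mcross, cons_val]; ring

theorem mdot_mcross_right (x y : Fin 3 → ℝ) : mdot (mcross x y) y = 0 := by
  simp only [mdot, mcross, cons_val]; ring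

/-- The Lorentzian Lagrange identity. -/
theorem mdot_mcross_mcross (x y : Fin 3 → ℝ) :
    mdot (mcross x y) (mcross x y) = mdot x y ^ 2 - mdot x x * mdot y y := by
  simp only [mdot, mcross, cons_val]; ring

theorem MemDelta4.of_mdot {v w : Fin 3 → ℝ} (hv : mdot v v = 0) (hw : mdot w w = 0)
    (hvw : mdot v w = -2) : MemDelta4 v w := by
  refine ⟨⟨?_, hv⟩, ⟨?_, hw⟩, hvw⟩ <;> rintro rfl <;> simp [mdot] at hvw

theorem mdot_lcn_lp (lp lm : ℝ → Fin 3 → ℝ) (t : ℝ) : mdot (lcn lp lm t) (lp t) = 0 := by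
  rw [lcn, mdot_smul_left, mdot_mcross_left, mul_zero]

theorem mdot_lcn_lm (lp lm : ℝ → Fin 3 → ℝ) (t : ℝ) : mdot (lcn lp lm t) (lm t) = 0 := by
  rw [lcn, mdot_smul_left, mdot_mcross_right, mul_zero]

theorem mdot_lcn_lcn {lp lm : ℝ → Fin 3 → ℝ} {t : ℝ} (h : MemDelta4 (lp t) (lm t)) :
    mdot (lcn lp lm t) (lcn lp lm t) = 1 := by
  rw [lcn, mdot_smul_left, mdot_smul_right, mdot_mcross_mcross, h.1.2, h.2.2]
  norm_num

/-- The Gram matrix of the pseudo-orthonormal frame `(nᵀ + n, nᵀ - n, nˢ)`. -/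
theorem mdot_fields {lp lm : ℝ → Fin 3 → ℝ} {t : ℝ} (h : MemDelta4 (lp t) (lm t)) :
    mdot (fieldLtp lp lm t) (fieldLtp lp lm t) = 0 ∧
    mdot (fieldLtm lp lm t) (fieldLtm lp lm t) = 0 ∧
    mdot (fieldLtp lp lm t) (fieldLtm lp lm t) = -2 ∧
    mdot (fieldLtp lp lm t) (fieldNS lp lm t) = 0 ∧
    mdot (fieldLtm lp lm t) (fieldNS lp lm t) = 0 ∧
    mdot (fieldNS lp lm t) (fieldNS lp lm t) = 1 := by
  have h1 := h.1.2
  have h2 := h.2.1.2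
  have h3 := h.2.2
  have h4 := (mdot_comm _ _).trans h3
  have h5 := mdot_lcn_lp lp lm t
  have h6 := mdot_lcn_lm lp lm t
  have h7 := (mdot_comm _ _).trans h5
  have h8 := (mdot_comm _ _).trans h6
  have h9 := mdot_lcn_lcn h
  simp only [fieldLtp, fieldLtm, fieldNS, fieldNT, fieldN, mdot_add_left, mdot_add_right,
    mdot_sub_left, mdot_sub_right, mdot_smul_left, mdot_smul_right, h1, h2, h3, h4, h5, h6, h7,
    h8, h9]
  norm_num

theorem Smooth3.apply {I : Set ℝ} {f : ℝ → Fin 3 → ℝ} (hf : Smooth3 I f) (i : Fin 3) :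
    Smooth1 I fun t => f t i :=
  contDiffOn_pi.1 hf i

theorem Smooth3.mdot {I : Set ℝ} {f g : ℝ → Fin 3 → ℝ} (hf : Smooth3 I f) (hg : Smooth3 I g) :
    Smooth1 I fun t => mdot (f t) (g t) :=
  ((((hf.apply 0).mul (hg.apply 0)).neg).add ((hf.apply 1).mul (hg.apply 1))).add
    ((hf.apply 2).mul (hg.apply 2))

theorem Smooth3.mcross {I : Set ℝ} {f g : ℝ → Fin 3 → ℝ} (hf : Smooth3 I f)
    (hg : Smooth3 I g) : Smooth3 I fun t => mcross (f t) (g t) := by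
  have key (i j : Fin 3) : Smooth1 I fun t => f t i * g t j - f t j * g t i :=
    ((hf.apply i).mul (hg.apply j)).sub ((hf.apply j).mul (hg.apply i))
  refine contDiffOn_pi.2 fun i => ?_
  fin_cases i
  · exact (key 1 2).neg
  · exact key 2 0
  · exact key 0 1

theorem Smooth3.add {I : Set ℝ} {f g : ℝ → Fin 3 → ℝ} (hf : Smooth3 I f) (hg : Smooth3 I g) :
    Smooth3 I fun t => f t + g t :=
  ContDiffOn.add hf hg

theorem Smooth3.sub {I : Set ℝ} {f g : ℝ → Fin 3 → ℝ} (hf : Smooth3 I f) (hg : Smooth3 I g) :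
    Smooth3 I fun t => f t - g t :=
  ContDiffOn.sub hf hg

theorem Smooth1.smul {I : Set ℝ} {c : ℝ → ℝ} {f : ℝ → Fin 3 → ℝ} (hc : Smooth1 I c)
    (hf : Smooth3 I f) : Smooth3 I fun t => c t • f t :=
  ContDiffOn.smul hc hf

theorem smooth1_const (I : Set ℝ) (c : ℝ) : Smooth1 I fun _ => c := contDiffOn_const

section Frame

variable {I : Set ℝ} {lp lm : ℝ → Fin 3 → ℝ}

theorem smooth3_lcn (hp : Smooth3 I lp) (hm : Smooth3 I lm) : Smooth3 I (lcn lp lm) :=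
  (smooth1_const I _).smul (hp.mcross hm)

theorem smooth3_fieldNS (hp : Smooth3 I lp) (hm : Smooth3 I lm) :
    Smooth3 I (fieldNS lp lm) :=
  (smooth1_const I _).smul (hp.sub hm)

theorem smooth3_fieldLtp (hp : Smooth3 I lp) (hm : Smooth3 I lm) :
    Smooth3 I (fieldLtp lp lm) :=
  ((smooth1_const I _).smul (hp.add hm)).add (smooth3_lcn hp hm)

theorem smooth3_fieldLtm (hp : Smooth3 I lp) (hm : Smooth3 I lm) :
    Smooth3 I (fieldLtm lp lm) :=
  ((smooth1_const I _).smul (hp.add hm)).sub (smooth3_lcn hp hm)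

end Frame

theorem ContDiffOn.hasDerivAt_of_isOpen {E : Type*} [NormedAddCommGroup E] [NormedSpace ℝ E]
    {I : Set ℝ} {f : ℝ → E} (hf : ContDiffOn ℝ (⊤ : ℕ∞) f I) (hI : IsOpen I) {t : ℝ}
    (ht : t ∈ I) : HasDerivAt f (deriv f t) t :=
  ((hf.differentiableOn (by simp)).differentiableAt (hI.mem_nhds ht)).hasDerivAt

/-- The derivative of the displaced curve `γ + λ ℓ̃⁺` in the frame `(ℓ̃⁺, ℓ̃⁻, nˢ)`. -/
theorem HasLightconeCurvature.hasDerivAt_displaced {I : Set ℝ} (hI : IsOpen I)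
    {γ lp lm : ℝ → Fin 3 → ℝ} {κ₁ κ₂ κ₃ α β lam : ℝ → ℝ}
    (hF : IsLightconeFramedCurve I γ lp lm)
    (hC : HasLightconeCurvature I γ lp lm κ₁ κ₂ κ₃ α β) (hlam : Smooth1 I lam)
    {t : ℝ} (ht : t ∈ I) :
    HasDerivAt (fun s => γ s + lam s • fieldLtp lp lm s)
      (((α t + β t) / 2 + deriv lam t + lam t * (κ₂ t + κ₃ t)) • fieldLtp lp lm t
        + ((α t + β t) / 2) • fieldLtm lp lm t
        + (α t - β t + lam t * (κ₁ t + κ₂ t - κ₃ t)) • fieldNS lp lm t) t := by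
  have hγ := ContDiffOn.hasDerivAt_of_isOpen hF.smooth_base hI ht
  have hp := ContDiffOn.hasDerivAt_of_isOpen hF.smooth_lp hI ht
  have hm := ContDiffOn.hasDerivAt_of_isOpen hF.smooth_lm hI ht
  have hn := ContDiffOn.hasDerivAt_of_isOpen (smooth3_lcn hF.smooth_lp hF.smooth_lm) hI ht
  have hl := ContDiffOn.hasDerivAt_of_isOpen hlam hI ht
  rw [hC.deriv_base t ht] at hγ
  rw [hC.deriv_lp t ht] at hp
  rw [hC.deriv_lm t ht] at hm
  rw [hC.deriv_n t ht] at hn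
  refine (hγ.add (hl.smul (((hp.add hm).const_smul (1 / 2 : ℝ)).add hn))).congr_deriv ?_
  simp only [fieldLtp, fieldLtm, fieldNS, fieldNT, fieldN, Pi.add_apply, Pi.smul_apply]
  module

/-- `(ℓ̃⁺,ℓ̄⁺)`-Bertrand lightcone framed curves: existence condition. -/
theorem bertrand_ltp_lpbar
    (I : Set ℝ) (hIo : IsOpen I) (hIc : I.OrdConnected)
    (γ lp lm : ℝ → Fin 3 → ℝ) (κ₁ κ₂ κ₃ α β : ℝ → ℝ)
    (hF : IsLightconeFramedCurve I γ lp lm)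
    (hC : HasLightconeCurvature I γ lp lm κ₁ κ₂ κ₃ α β) :
    IsBertrand I fieldLtp fieldLp γ lp lm ↔
      ∃ lam k : ℝ → ℝ, Smooth1 I lam ∧ Smooth1 I k ∧ NotIdentZero I lam ∧
        ∀ t ∈ I, k t * (α t + β t) + α t - β t +
          lam t * (κ₁ t + κ₂ t - κ₃ t) = 0 := by
  have hP := smooth3_fieldLtp hF.smooth_lp hF.smooth_lm
  have hM := smooth3_fieldLtm hF.smooth_lp hF.smooth_lm
  have hS := smooth3_fieldNS hF.smooth_lp hF.smooth_lm
  constructor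
  · rintro ⟨γ', lp', lm', -, hF', lam, hlam, hlam0, hγ', hv⟩
    refine ⟨lam, fun t => -(1 / 2) * mdot (lm' t) (fieldNS lp lm t), hlam,
      (smooth1_const I _).mul (hF'.smooth_lm.mdot hS), hlam0, fun t ht => ?_⟩
    obtain ⟨α', β', -, -, hd⟩ := hF'.exists_coeffs
    have hev : γ' =ᶠ[nhds t] fun s => γ s + lam s • fieldLtp lp lm s := by
      filter_upwards [hIo.mem_nhds ht] with s hs using hγ' s hs
    have hD := hev.deriv_eq.trans (hC.hasDerivAt_displaced hIo hF hlam ht).deriv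
    rw [hd t ht, show lp' t = fieldLtp lp lm t from (hv t ht).symm] at hD
    have hw : mdot (fieldLtp lp lm t) (lm' t) = -2 :=
      (congrArg (fun x => mdot x (lm' t)) (hv t ht)).trans (hF'.delta4 t ht).2.2
    obtain ⟨h1, -, h3, h4, h5, h6⟩ := mdot_fields (hF.delta4 t ht)
    have hDP := congrArg (mdot (fieldLtp lp lm t)) hD
    have hDS := congrArg (fun x => mdot x (fieldNS lp lm t)) hD
    simp only [mdot_add_right, mdot_smul_right, h1, h3, h4, hw] at hDP
    simp only [mdot_add_left, mdot_smul_left, h4, h5, h6] at hDS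
    have hβ : β' t = (α t + β t) / 2 := by linarith
    rw [hβ] at hDS
    linear_combination -hDS
  · rintro ⟨lam, k, hlam, hk, hlam0, h⟩
    refine ⟨fun t => γ t + lam t • fieldLtp lp lm t, fieldLtp lp lm,
      fun t => fieldLtm lp lm t + (-2 * k t) • fieldNS lp lm t + (k t ^ 2) • fieldLtp lp lm t,
      hF, ⟨?_, hP, ?_, fun t ht => ?_, ?_⟩, lam, hlam, hlam0, fun _ _ => rfl, fun _ _ => rfl⟩
    · exact hF.smooth_base.add (hlam.smul hP)
    · exact (hM.add (Smooth1.smul ((smooth1_const I _).mul hk) hS)).add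
        (Smooth1.smul (ContDiffOn.pow hk 2) hP)
    · obtain ⟨h1, h2, h3, h4, h5, h6⟩ := mdot_fields (hF.delta4 t ht)
      have h3' := (mdot_comm _ _).trans h3
      have h4' := (mdot_comm _ _).trans h4
      have h5' := (mdot_comm _ _).trans h5
      refine MemDelta4.of_mdot h1 ?_ ?_ <;>
        simp only [mdot_add_left, mdot_add_right, mdot_smul_left, mdot_smul_right, h1, h2, h3,
          h4, h5, h6, h3', h4', h5'] <;> ring
    · have hlam' : Smooth1 I (deriv lam) := hlam.deriv_of_isOpen hIo (by simp)
      have hαβ : Smooth1 I fun t => (α t + β t) / 2 :=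
        (ContDiffOn.add hC.smooth_α hC.smooth_β).div_const 2
      refine ⟨fun t => (α t + β t) / 2 * (1 - k t ^ 2) + deriv lam t + lam t * (κ₂ t + κ₃ t),
        fun t => (α t + β t) / 2, ?_, hαβ, fun t ht => ?_⟩
      · exact ((hαβ.mul ((smooth1_const I 1).sub (ContDiffOn.pow hk 2))).add hlam').add
          (hlam.mul (ContDiffOn.add hC.smooth_κ₂ hC.smooth_κ₃))
      · rw [(hC.hasDerivAt_displaced hIo hF hlam ht).deriv,
          show α t - β t + lam t * (κ₁ t + κ₂ t - κ₃ t) = -(k t * (α t + β t)) by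
            linear_combination h t ht]
        module
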